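/- Let I = [a,b] be a nondegenerate compact real interval and let f : I → I be continuous, transitive, and piecewise monotone. Suppose φ₁, φ₂ : I → [0,1] are increasing homeomorphisms such that both g₁ = φ₁ ∘ f ∘ φ₁⁻¹ and g₂ = φ₂ ∘ f ∘ φ₂⁻¹ are continuous piecewise monotone maps of constant slopes β₁ and β₂ respectively. Then φ₁ = φ₂; in particular g₁ = g₂ and β₁ = β₂, i.e., f is conjugate via an increasing homeomorphism to exactly one map of constant slope. -/

import Mathlib

open Set

/-- On every interval without cut points from `T` in its interior, `f` scales `h` by `γ`. -/
def Scal (a b : ℝ) (f h : ℝ → ℝ) (γ : ℝ) (T : Finset ℝ) : Prop :=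
  ∀ x ∈ Icc a b, ∀ y ∈ Icc a b, x ≤ y → (∀ t ∈ T, ¬ (x < t ∧ t < y)) →
    |h (f y) - h (f x)| = γ * |h y - h x|

lemma Scal.mono {a b : ℝ} {f h : ℝ → ℝ} {γ : ℝ} {T T' : Finset ℝ}
    (H : Scal a b f h γ T) (hT : T ⊆ T') : Scal a b f h γ T' :=
  fun x hx y hy hxy h0 => H x hx y hy hxy fun t ht => h0 t (hT ht)

/-- Superadditive interval functions bounded below on cut-free intervals. -/
lemma cut_bound {a b : ℝ} (T : Finset ℝ) (D : ℝ → ℝ → ℝ) (C : ℝ)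
    (hadd : ∀ x ∈ Icc a b, ∀ t ∈ Icc a b, ∀ y ∈ Icc a b, x ≤ t → t ≤ y → D x t + D t y ≤ D x y)
    (h0 : ∀ x ∈ Icc a b, ∀ y ∈ Icc a b, x ≤ y → (∀ t ∈ T, ¬ (x < t ∧ t < y)) → -C ≤ D x y) :
    ∀ p : ℕ, ∀ x ∈ Icc a b, ∀ y ∈ Icc a b, x ≤ y → (T.filter fun t => x < t ∧ t < y).card = p →
      -((p + 1 : ℝ) * C) ≤ D x y := by
  intro p
  induction p using Nat.strong_induction_on with
  | _ p ih =>
    intro x hx y hy hxy hp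
    by_cases hne : ∀ t ∈ T, ¬ (x < t ∧ t < y)
    · have h1 := h0 x hx y hy hxy hne
      have : p = 0 := by
        rw [← hp, Finset.card_eq_zero, Finset.filter_eq_empty_iff]
        exact hne
      subst this
      simpa using h1
    · push Not at hne
      obtain ⟨t, htT, hxt, hty⟩ := hne
      have ht : t ∈ Icc a b := ⟨hx.1.trans hxt.le, hty.le.trans hy.2⟩
      set A := T.filter fun s => x < s ∧ s < t with hA
      set B := T.filter fun s => t < s ∧ s < y with hB
      have hsplit : (T.filter fun s => x < s ∧ s < y) = insert t (A ∪ B) := by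
        ext s
        simp only [hA, hB, Finset.mem_filter, Finset.mem_insert, Finset.mem_union]
        constructor
        · rintro ⟨h1, h2, h3⟩
          rcases lt_trichotomy s t with h | h | h
          · right; left; exact ⟨h1, h2, h⟩
          · left; exact h
          · right; right; exact ⟨h1, h, h3⟩
        · rintro (rfl | ⟨h1, h2, h3⟩ | ⟨h1, h2, h3⟩)
          · exact ⟨htT, hxt, hty⟩
          · exact ⟨h1, h2, h3.trans hty⟩
          · exact ⟨h1, hxt.trans h2, h3⟩
      have hnot : t ∉ A ∪ B := by simp [hA, hB]
      have hdisj : Disjoint A B := by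
        rw [Finset.disjoint_left]
        intro s h1 h2
        simp only [hA, hB, Finset.mem_filter] at h1 h2
        linarith [h1.2.2, h2.2.1]
      have hcard : p = A.card + B.card + 1 := by
        rw [← hp, hsplit, Finset.card_insert_of_notMem hnot, Finset.card_union_of_disjoint hdisj]
      have h1 := ih A.card (by omega) x hx t ht hxt.le rfl
      have h2 := ih B.card (by omega) t ht y hy hty.le rfl
      have h3 := hadd x hx t ht y hy hxt.le hty.le
      have : (p : ℝ) = A.card + B.card + 1 := by rw [hcard]; push_cast; ring
      rw [this]
      linarith

lemma scal_lip_le {a b : ℝ} {f h : ℝ → ℝ} {γ : ℝ} {T : Finset ℝ}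
    (hm : MonotoneOn h (Icc a b)) (H : Scal a b f h γ T) :
    ∀ x ∈ Icc a b, ∀ y ∈ Icc a b, x ≤ y → |h (f y) - h (f x)| ≤ γ * |h y - h x| := by
  intro x hx y hy hxy
  have := cut_bound (a := a) (b := b) T (fun x y => γ * (h y - h x) - |h (f y) - h (f x)|) 0
    (by
      intro x hx t ht y hy h1 h2
      have := abs_sub_le (h (f y)) (h (f t)) (h (f x))
      linarith)
    (by
      intro x hx y hy hxy h0
      have := H x hx y hy hxy h0
      rw [abs_of_nonneg (sub_nonneg.2 (hm hx hy hxy))] at this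
      linarith) _ x hx y hy hxy rfl
  rw [abs_of_nonneg (sub_nonneg.2 (hm hx hy hxy))]
  linarith

lemma scal_lip {a b : ℝ} {f h : ℝ → ℝ} {γ : ℝ} {T : Finset ℝ}
    (hm : MonotoneOn h (Icc a b)) (H : Scal a b f h γ T) :
    ∀ x ∈ Icc a b, ∀ y ∈ Icc a b, |h (f y) - h (f x)| ≤ γ * |h y - h x| := by
  intro x hx y hy
  rcases le_total x y with hxy | hxy
  · exact scal_lip_le hm H x hx y hy hxy
  · rw [abs_sub_comm, abs_sub_comm (h y)]
    exact scal_lip_le hm H y hy x hx hxy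

lemma orbit_mem {a b : ℝ} {f : ℝ → ℝ} (hf : MapsTo f (Icc a b) (Icc a b)) {x : ℝ}
    (hx : x ∈ Icc a b) (n : ℕ) : f^[n] x ∈ Icc a b := hf.iterate n hx

/-- every open subinterval is visited at arbitrarily late times -/
lemma visit {a b : ℝ} {f : ℝ → ℝ} {x₀ : ℝ}
    (hd : Icc a b ⊆ closure (Set.range fun n : ℕ => f^[n] x₀))
    {u v : ℝ} (hu : a ≤ u) (hv : v ≤ b) (huv : u < v) (N : ℕ) :
    ∃ n, N ≤ n ∧ f^[n] x₀ ∈ Ioo u v := by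
  set S : Set ℝ := (fun n : ℕ => f^[n] x₀) '' {n | n < N} with hS
  have hSf : S.Finite := (Set.finite_lt_nat N).image _
  have hopen : IsOpen (Ioo u v \ S) := isOpen_Ioo.sdiff hSf.isClosed
  have hne : (Ioo u v \ S).Nonempty := ((Ioo_infinite huv).sdiff hSf).nonempty
  obtain ⟨z, hz⟩ := hne
  have hzc : z ∈ closure (Set.range fun n : ℕ => f^[n] x₀) :=
    hd ⟨hu.trans hz.1.1.le, hz.1.2.le.trans hv⟩
  obtain ⟨w, hw, n, rfl⟩ := mem_closure_iff.1 hzc _ hopen hz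
  refine ⟨n, ?_, hw.1⟩
  by_contra hlt
  exact hw.2 ⟨n, not_le.1 hlt, rfl⟩

/-- a scaled monotone function constant somewhere is constant -/
lemma const_of_flat {a b : ℝ} {f h : ℝ → ℝ} {γ : ℝ} {T : Finset ℝ}
    (hf : MapsTo f (Icc a b) (Icc a b)) {x₀ : ℝ} (hx₀ : x₀ ∈ Icc a b)
    (hd : Icc a b ⊆ closure (Set.range fun n : ℕ => f^[n] x₀))
    (hm : MonotoneOn h (Icc a b)) (hc : ContinuousOn h (Icc a b)) (H : Scal a b f h γ T)
    {u v : ℝ} (hu : u ∈ Icc a b) (hv : v ∈ Icc a b) (huv : u < v) (hflat : h v ≤ h u) :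
    ∀ x ∈ Icc a b, ∀ y ∈ Icc a b, h x = h y := by
  obtain ⟨n, -, hn⟩ := visit hd hu.1 hv.2 huv 0
  obtain ⟨n', hn', hn'2⟩ := visit hd hu.1 hv.2 huv (n + 1)
  have hflat' : ∀ z ∈ Ioo u v, h z = h u := by
    intro z hz
    have hzI : z ∈ Icc a b := ⟨hu.1.trans hz.1.le, hz.2.le.trans hv.2⟩
    exact le_antisymm ((hm hzI hv hz.2.le).trans hflat) (hm hu hzI hz.1.le)
  have heq : h (f^[n] x₀) = h (f^[n'] x₀) := by rw [hflat' _ hn, hflat' _ hn'2]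
  have hstep : ∀ x ∈ Icc a b, ∀ y ∈ Icc a b, h x = h y → h (f x) = h (f y) := by
    intro x hx y hy hxy
    have := scal_lip hm H x hx y hy
    rw [hxy, sub_self, abs_zero, mul_zero] at this
    have := abs_nonpos_iff.1 this
    linarith
  have hper : ∀ r, h (f^[n + r] x₀) = h (f^[n' + r] x₀) := by
    intro r
    induction r with
    | zero => exact heq
    | succ r ih =>
      rw [← add_assoc, ← add_assoc, Function.iterate_succ_apply', Function.iterate_succ_apply']
      exact hstep _ (orbit_mem hf hx₀ _) _ (orbit_mem hf hx₀ _) ih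
  set V : Set ℝ := (fun k : ℕ => h (f^[k] x₀)) '' {k | k < n'} with hV
  have hVf : V.Finite := (Set.finite_lt_nat n').image _
  have hall : ∀ k, h (f^[k] x₀) ∈ V := by
    intro k
    induction k using Nat.strong_induction_on with
    | _ k ih =>
      by_cases hk : k < n'
      · exact ⟨k, hk, rfl⟩
      · have := hper (k - n')
        rw [show n' + (k - n') = k by omega] at this
        rw [← this]
        exact ih _ (by omega)
  have himg : h '' Icc a b ⊆ V := by
    rintro _ ⟨x, hx, rfl⟩
    set O := Set.range fun n : ℕ => f^[n] x₀ with hO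
    have hOI : O ⊆ Icc a b := by
      rintro _ ⟨k, rfl⟩; exact orbit_mem hf hx₀ k
    have h1 : h x ∈ closure (h '' O) :=
      ((hc x hx).mono hOI).mem_closure_image (hd hx)
    have h2 : h '' O ⊆ V := by
      rintro _ ⟨_, ⟨k, rfl⟩, rfl⟩; exact hall k
    exact (hVf.isClosed.closure_subset_iff.2 h2) h1
  have hsub : (h '' Icc a b).Subsingleton :=
    (hVf.subset himg).countable.isTotallyDisconnected _ Subset.rfl (isPreconnected_Icc.image h hc)
  intro x hx y hy
  exact hsub ⟨x, hx, rfl⟩ ⟨y, hy, rfl⟩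

/-- expansion -/
lemma one_lt_slope {a b : ℝ} (hab : a < b) {f h : ℝ → ℝ} {γ : ℝ} {T : Finset ℝ}
    (hf : MapsTo f (Icc a b) (Icc a b)) (hfc : ContinuousOn f (Icc a b))
    {x₀ : ℝ} (hx₀ : x₀ ∈ Icc a b)
    (hd : Icc a b ⊆ closure (Set.range fun n : ℕ => f^[n] x₀))
    (hm : StrictMonoOn h (Icc a b)) (H : Scal a b f h γ T) : 1 < γ := by
  by_contra hγ
  push Not at hγ
  obtain ⟨p, hp, hfp⟩ := exists_mem_Icc_isFixedPt_of_mapsTo hfc hab.le hf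
  have hdec1 : ∀ n, |h (f^[n + 1] x₀) - h p| ≤ |h (f^[n] x₀) - h p| := by
    intro n
    have := scal_lip hm.monotoneOn H p hp _ (orbit_mem hf hx₀ n)
    rw [hfp.eq] at this
    rw [Function.iterate_succ_apply']
    nlinarith [abs_nonneg (h (f^[n] x₀) - h p)]
  have hdec : Antitone fun n => |h (f^[n] x₀) - h p| := antitone_nat_of_succ_le hdec1
  rcases lt_or_eq_of_le hp.2 with hpb | hpb
  · set u := (p + b) / 2 with hu
    have h1 : p < u := by linarith
    have h2 : u < b := by linarith
    have huI : u ∈ Icc a b := ⟨hp.1.trans h1.le, h2.le⟩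
    obtain ⟨N, -, hN⟩ := visit hd hp.1 h2.le h1 0
    obtain ⟨n, hn, hn2⟩ := visit hd huI.1 le_rfl h2 N
    have h3 := hdec hn
    dsimp only at h3
    have h4 := hm hp (orbit_mem hf hx₀ N) hN.1
    have h5 := hm (orbit_mem hf hx₀ N) huI hN.2
    have h6 := hm huI (orbit_mem hf hx₀ n) hn2.1
    rw [abs_of_pos (by linarith), abs_of_pos (by linarith)] at h3
    linarith
  · set u := (a + p) / 2 with hu
    have h1 : a < u := by linarith
    have h2 : u < p := by linarith
    have huI : u ∈ Icc a b := ⟨h1.le, by linarith⟩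
    obtain ⟨N, -, hN⟩ := visit hd huI.1 hp.2 h2 0
    obtain ⟨n, hn, hn2⟩ := visit hd le_rfl huI.2 h1 N
    have h3 := hdec hn
    dsimp only at h3
    have h4 := hm (orbit_mem hf hx₀ N) hp hN.2
    have h5 := hm huI (orbit_mem hf hx₀ N) hN.1
    have h6 := hm (orbit_mem hf hx₀ n) huI hn2.2
    rw [abs_of_neg (by linarith), abs_of_neg (by linarith)] at h3
    linarith

lemma scal_iterate {a b : ℝ} {f l : ℝ → ℝ} {β : ℝ} {T : Finset ℝ}
    (hf : MapsTo f (Icc a b) (Icc a b)) (hfc : ContinuousOn f (Icc a b)) (hβ : 0 < β)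
    (hl : StrictMonoOn l (Icc a b)) (Hl : Scal a b f l β T) (k : ℕ) :
    ∃ T' : Finset ℝ, ∀ (h : ℝ → ℝ) (γ : ℝ), Scal a b f h γ T → Scal a b (f^[k]) h (γ ^ k) T' := by
  induction k with
  | zero => exact ⟨∅, fun h γ _ x _ y _ _ _ => by simp⟩
  | succ k ih =>
    obtain ⟨T₁, hT₁⟩ := ih
    have hfin1 : ∀ t, {x | x ∈ Icc a b ∧ f x = t}.Finite := by
      intro t
      have hkey : ∀ x ∈ Icc a b, ∀ y ∈ Icc a b, f x = f y → x < y →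
          (T.filter fun s => s < x) ≠ (T.filter fun s => s < y) := by
        intro x hx y hy hxy hlt heq
        have : ∀ s ∈ T, ¬ (x < s ∧ s < y) := by
          rintro s hs ⟨h1, h2⟩
          have : s ∈ T.filter fun s => s < x := by
            rw [heq]; exact Finset.mem_filter.2 ⟨hs, h2⟩
          exact lt_asymm h1 (Finset.mem_filter.1 this).2
        have h3 := Hl x hx y hy hlt.le this
        rw [hxy, sub_self, abs_zero] at h3
        have h4 := hl hx hy hlt
        have : 0 < β * |l y - l x| := mul_pos hβ (abs_pos.2 (by linarith))
        linarith
      refine Set.Finite.of_finite_image (f := fun x => T.filter fun s => s < x)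
        ((T.powerset.finite_toSet).subset ?_) ?_
      · rintro _ ⟨x, _, rfl⟩
        exact Finset.mem_coe.2 (Finset.mem_powerset.2 (Finset.filter_subset _ _))
      · rintro x ⟨hx, hx2⟩ y ⟨hy, hy2⟩ hxy
        rcases lt_trichotomy x y with h | h | h
        · exact absurd hxy (hkey x hx y hy (hx2.trans hy2.symm) h)
        · exact h
        · exact absurd hxy.symm (hkey y hy x hx (hy2.trans hx2.symm) h)
    have hfin : {x | x ∈ Icc a b ∧ f x ∈ T₁}.Finite := by
      have : {x | x ∈ Icc a b ∧ f x ∈ T₁} = ⋃ t ∈ T₁, {x | x ∈ Icc a b ∧ f x = t} := by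
        ext x; simp
      rw [this]
      exact T₁.finite_toSet.biUnion fun t _ => hfin1 t
    refine ⟨T ∪ hfin.toFinset, fun h γ Hh x hx y hy hxy hcut => ?_⟩
    have h1 := Hh x hx y hy hxy fun t ht => hcut t (Finset.mem_union_left _ ht)
    have hfcxy : ContinuousOn f (Icc x y) := hfc.mono (Icc_subset_Icc hx.1 hy.2)
    rw [Function.iterate_succ_apply, Function.iterate_succ_apply, pow_succ, mul_assoc, ← h1]
    have hno : ∀ z ∈ Ioo x y, f z ∉ T₁ := by
      intro z hz hzT
      refine hcut z (Finset.mem_union_right _ ?_) hz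
      rw [Set.Finite.mem_toFinset]
      exact ⟨⟨hx.1.trans hz.1.le, hz.2.le.trans hy.2⟩, hzT⟩
    rcases le_total (f x) (f y) with hfxy | hfxy
    · refine hT₁ h γ Hh _ (hf hx) _ (hf hy) hfxy ?_
      rintro t ht htt
      obtain ⟨z, hz, rfl⟩ := intermediate_value_Ioo hxy hfcxy htt
      exact hno z hz ht
    · rw [abs_sub_comm, abs_sub_comm (h (f y))]
      refine hT₁ h γ Hh _ (hf hy) _ (hf hx) hfxy ?_
      rintro t ht htt
      obtain ⟨z, hz, rfl⟩ := intermediate_value_Ioo' hxy hfcxy htt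
      exact hno z hz ht

lemma base_bound {a b : ℝ} {l h : ℝ → ℝ}
    (hl : StrictMonoOn l (Icc a b)) (hlc : ContinuousOn l (Icc a b))
    (hh : StrictMonoOn h (Icc a b)) (hhc : ContinuousOn h (Icc a b)) {K : ℝ} (hK : 0 < K) :
    ∃ c > 0, ∀ x ∈ Icc a b, ∀ y ∈ Icc a b, x ≤ y → c * (l y - l x - K) ≤ h y - h x := by
  have hlc2 : ContinuousOn (fun q : ℝ × ℝ => l q.2 - l q.1) (Icc a b ×ˢ Icc a b) :=
    (hlc.comp continuousOn_snd fun q hq => hq.2).sub (hlc.comp continuousOn_fst fun q hq => hq.1)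
  have hhc2 : ContinuousOn (fun q : ℝ × ℝ => h q.2 - h q.1) (Icc a b ×ˢ Icc a b) :=
    (hhc.comp continuousOn_snd fun q hq => hq.2).sub (hhc.comp continuousOn_fst fun q hq => hq.1)
  set S : Set (ℝ × ℝ) := (Icc a b ×ˢ Icc a b) ∩ (fun q : ℝ × ℝ => l q.2 - l q.1) ⁻¹' Ici K with hS
  have hIc : IsCompact (Icc a b ×ˢ Icc a b) := isCompact_Icc.prod isCompact_Icc
  have hScl : IsClosed S := hlc2.preimage_isClosed_of_isClosed hIc.isClosed isClosed_Ici
  have hSc : IsCompact S := hIc.of_isClosed_subset hScl inter_subset_left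
  have hpos : ∀ q ∈ S, 0 < h q.2 - h q.1 := by
    rintro ⟨x, y⟩ ⟨⟨hx, hy⟩, hq⟩
    have hq' : K ≤ l y - l x := hq
    have : x < y := (hl.lt_iff_lt hx hy).1 (by linarith)
    exact sub_pos.2 (hh hx hy this)
  rcases S.eq_empty_or_nonempty with hemp | hne
  · refine ⟨1, one_pos, fun x hx y hy hxy => ?_⟩
    have : l y - l x < K := by
      by_contra hcon
      have : (x, y) ∈ S := ⟨⟨hx, hy⟩, not_lt.1 hcon⟩
      rw [hemp] at this
      exact this
    have := hh.monotoneOn hx hy hxy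
    linarith
  · obtain ⟨q, hq, hmin⟩ := hSc.exists_isMinOn hne (hhc2.mono inter_subset_left)
    obtain ⟨q', hq', hmax⟩ := hSc.exists_isMaxOn hne (hlc2.mono inter_subset_left)
    have hc0 := hpos q hq
    have hL : 0 < l q'.2 - l q'.1 := lt_of_lt_of_le hK hq'.2
    refine ⟨(h q.2 - h q.1) / (l q'.2 - l q'.1), div_pos hc0 hL, fun x hx y hy hxy => ?_⟩
    by_cases hcase : K ≤ l y - l x
    · have hm : (x, y) ∈ S := ⟨⟨hx, hy⟩, hcase⟩
      have h1 : h q.2 - h q.1 ≤ h y - h x := hmin hm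
      have h2 : l y - l x ≤ l q'.2 - l q'.1 := hmax hm
      refine le_trans ?_ h1
      rw [div_mul_eq_mul_div, div_le_iff₀ hL]
      exact mul_le_mul_of_nonneg_left (by linarith) hc0.le
    · have := hh.monotoneOn hx hy hxy
      have h3 : (h q.2 - h q.1) / (l q'.2 - l q'.1) * (l y - l x - K) ≤ 0 :=
        mul_nonpos_of_nonneg_of_nonpos (div_pos hc0 hL).le (by linarith)
      linarith

lemma gap {a b : ℝ} {l : ℝ → ℝ} (hl : StrictMonoOn l (Icc a b)) (T : Finset ℝ) :
    ∃ δ > 0, ∀ s ∈ T, ∀ t ∈ T, s ∈ Icc a b → t ∈ Icc a b → s < t → δ ≤ l t - l s := by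
  set P := (T ×ˢ T).filter (fun q => q.1 ∈ Icc a b ∧ q.2 ∈ Icc a b ∧ q.1 < q.2) with hP
  rcases P.eq_empty_or_nonempty with he | hne
  · refine ⟨1, one_pos, fun s hs t ht h1 h2 h3 => ?_⟩
    have : (s, t) ∈ P := Finset.mem_filter.2 ⟨Finset.mem_product.2 ⟨hs, ht⟩, h1, h2, h3⟩
    rw [he] at this
    simp at this
  · obtain ⟨q, hq, hmin⟩ := P.exists_min_image (fun q => l q.2 - l q.1) hne
    have hq' := (Finset.mem_filter.1 hq).2
    refine ⟨l q.2 - l q.1, sub_pos.2 (hl hq'.1 hq'.2.1 hq'.2.2), fun s hs t ht h1 h2 h3 => ?_⟩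
    exact hmin (s, t) (Finset.mem_filter.2 ⟨Finset.mem_product.2 ⟨hs, ht⟩, h1, h2, h3⟩)

lemma main_bound {a b : ℝ} {f l h : ℝ → ℝ} {β γ : ℝ} {T : Finset ℝ}
    (hf : MapsTo f (Icc a b) (Icc a b)) 
    (hl : StrictMonoOn l (Icc a b)) (hlc : ContinuousOn l (Icc a b))
    (hh : StrictMonoOn h (Icc a b)) (hhc : ContinuousOn h (Icc a b))
    (Hl : Scal a b f l β T) (Hh : Scal a b f h γ T) (hβ : 2 < β) (hγ : 0 ≤ γ) :
    ∃ c > 0, ∃ K : ℝ, ∀ n : ℕ, ∀ x ∈ Icc a b, ∀ y ∈ Icc a b, x ≤ y →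
      c * ((β ^ n + 2 ^ n) / 2 * (l y - l x) - K * 2 ^ n) ≤ γ ^ n * (h y - h x) := by
  obtain ⟨δ, hδ, hgap⟩ := gap hl T
  set M : ℝ := T.card + 1 with hM
  have hMpos : 0 < M := by positivity
  set K : ℝ := (β - 2) * δ / (2 * M) with hKdef
  have hK : 0 < K := div_pos (mul_pos (by linarith) hδ) (by positivity)
  have hKM : M * K = (β - 2) * δ / 2 := by rw [hKdef]; field_simp
  obtain ⟨c, hc, hbase⟩ := base_bound hl hlc hh hhc hK
  refine ⟨c, hc, K, fun n => ?_⟩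
  induction n with
  | zero =>
    intro x hx y hy hxy
    have := hbase x hx y hy hxy
    simp only [pow_zero, one_mul, mul_one]
    convert this using 2
    ring
  | succ n ih =>
    intro x hx y hy hxy
    set A : ℝ := (β ^ n + 2 ^ n) / 2 with hA
    have h2n : (0 : ℝ) < 2 ^ n := by positivity
    have ihabs : ∀ x ∈ Icc a b, ∀ y ∈ Icc a b,
        c * (A * |l y - l x| - K * 2 ^ n) ≤ γ ^ n * |h y - h x| := by
      intro x hx y hy
      rcases le_total x y with hxy | hxy
      · rw [abs_of_nonneg (sub_nonneg.2 (hl.monotoneOn hx hy hxy)),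
          abs_of_nonneg (sub_nonneg.2 (hh.monotoneOn hx hy hxy))]
        exact ih x hx y hy hxy
      · rw [abs_sub_comm, abs_of_nonneg (sub_nonneg.2 (hl.monotoneOn hy hx hxy)),
          abs_sub_comm, abs_of_nonneg (sub_nonneg.2 (hh.monotoneOn hy hx hxy))]
        exact ih y hy x hx hxy
    have hcut := cut_bound (a := a) (b := b) T
      (fun x y => γ ^ (n + 1) * (h y - h x) - c * (A * β) * (l y - l x)) (c * (K * 2 ^ n))
      (by
        intro x hx t ht y hy h1 h2
        apply le_of_eq
        ring)
      (by
        intro x hx y hy hxy h0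
        have h1 := Hl x hx y hy hxy h0
        have h2 := Hh x hx y hy hxy h0
        have h3 := ihabs _ (hf hx) _ (hf hy)
        rw [h1, h2, abs_of_nonneg (sub_nonneg.2 (hl.monotoneOn hx hy hxy)),
          abs_of_nonneg (sub_nonneg.2 (hh.monotoneOn hx hy hxy))] at h3
        rw [pow_succ]
        linarith) _ x hx y hy hxy rfl
    set p := (T.filter fun t => x < t ∧ t < y).card with hp
    have hlxy : 0 ≤ l y - l x := sub_nonneg.2 (hl.monotoneOn hx hy hxy)
    have hgoal : (β ^ (n + 1) + 2 ^ (n + 1)) / 2 * (l y - l x) - K * 2 ^ (n + 1)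
        ≤ A * β * (l y - l x) - (p + 1) * (K * 2 ^ n) := by
      have e1 : A * β * (l y - l x) = (β ^ (n + 1) + 2 ^ (n + 1)) / 2 * (l y - l x)
          + (β - 2) / 2 * 2 ^ n * (l y - l x) := by
        rw [hA, pow_succ, pow_succ]; ring
      have e2 : 0 ≤ (β - 2) / 2 * 2 ^ n * (l y - l x) :=
        mul_nonneg (mul_nonneg (by linarith) h2n.le) hlxy
      have e4 : 0 < K * 2 ^ n := mul_pos hK h2n
      have e5 : K * 2 ^ (n + 1) = 2 * (K * 2 ^ n) := by rw [pow_succ]; ring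
      rw [e1, e5]
      by_cases hp1 : p ≤ 1
      · have : (p : ℝ) ≤ 1 := by exact_mod_cast hp1
        nlinarith
      · obtain ⟨s, hs, t, ht, hst⟩ := Finset.one_lt_card.1 (not_le.1 hp1)
        have hlen : δ ≤ l y - l x := by
          rw [Finset.mem_filter] at hs ht
          have hsI : s ∈ Icc a b := ⟨hx.1.trans hs.2.1.le, hs.2.2.le.trans hy.2⟩
          have htI : t ∈ Icc a b := ⟨hx.1.trans ht.2.1.le, ht.2.2.le.trans hy.2⟩
          have a1 := hl hx hsI hs.2.1
          have a2 := hl hx htI ht.2.1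
          have a3 := hl hsI hy hs.2.2
          have a4 := hl htI hy ht.2.2
          rcases lt_or_gt_of_ne hst with h | h
          · have := hgap s hs.1 t ht.1 hsI htI h
            linarith
          · have := hgap t ht.1 s hs.1 htI hsI h
            linarith
        have hpM : (p : ℝ) + 1 ≤ M := by
          rw [hM]
          have : p ≤ T.card := Finset.card_filter_le _ _
          have : (p : ℝ) ≤ T.card := by exact_mod_cast this
          linarith
        have e6 : (p + 1 : ℝ) * (K * 2 ^ n) ≤ (β - 2) * δ / 2 * 2 ^ n := by
          rw [← hKM]
          calc (p + 1 : ℝ) * (K * 2 ^ n) ≤ M * (K * 2 ^ n) :=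
                mul_le_mul_of_nonneg_right hpM e4.le
            _ = _ := by ring
        have e7 : (β - 2) / 2 * 2 ^ n * δ ≤ (β - 2) / 2 * 2 ^ n * (l y - l x) :=
          mul_le_mul_of_nonneg_left hlen (mul_nonneg (by linarith) h2n.le)
        linarith
    have := mul_le_mul_of_nonneg_left hgoal hc.le
    linarith

open Filter Topology in
lemma compare {a b : ℝ} (hab : a < b) {f l h : ℝ → ℝ} {β γ : ℝ} {T : Finset ℝ}
    (hf : MapsTo f (Icc a b) (Icc a b)) (hfc : ContinuousOn f (Icc a b))
    (hl : StrictMonoOn l (Icc a b)) (hlc : ContinuousOn l (Icc a b))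
    (hh : StrictMonoOn h (Icc a b)) (hhc : ContinuousOn h (Icc a b))
    (Hl : Scal a b f l β T) (Hh : Scal a b f h γ T) (hβ : 1 < β) (hγ : 0 ≤ γ) :
    β ≤ γ ∧ (γ = β → ∃ c > 0, ∀ x ∈ Icc a b, ∀ y ∈ Icc a b, x ≤ y →
      c * (l y - l x) ≤ h y - h x) := by
  obtain ⟨k, hk⟩ := pow_unbounded_of_one_lt 2 hβ
  obtain ⟨T', hT'⟩ := scal_iterate hf hfc (by linarith) hl Hl k
  obtain ⟨c, hc, K, hmain⟩ := main_bound (hf.iterate k) hl hlc hh hhc (hT' l β Hl) (hT' h γ Hh)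
    hk (pow_nonneg hγ k)
  set B := β ^ k with hB
  set G := γ ^ k with hG
  have hBpos : 0 < B := by linarith
  have hdiv : ∀ n : ℕ, ∀ x ∈ Icc a b, ∀ y ∈ Icc a b, x ≤ y →
      c * ((l y - l x) / 2 - K * (2 / B) ^ n) ≤ (G / B) ^ n * (h y - h x) := by
    intro n x hx y hy hxy
    have h1 := hmain n x hx y hy hxy
    have hBn : 0 < B ^ n := pow_pos hBpos n
    have hlxy : 0 ≤ l y - l x := sub_nonneg.2 (hl.monotoneOn hx hy hxy)
    have h3 : c * (B ^ n / 2 * (l y - l x) - K * 2 ^ n) ≤ G ^ n * (h y - h x) := by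
      refine le_trans (mul_le_mul_of_nonneg_left ?_ hc.le) h1
      have : (0 : ℝ) ≤ 2 ^ n * (l y - l x) := by positivity
      linarith
    rw [div_pow, div_pow, div_mul_eq_mul_div, le_div_iff₀ hBn]
    refine le_trans (le_of_eq ?_) h3
    field_simp
  have hlim : Tendsto (fun n : ℕ => (2 / B) ^ n) atTop (𝓝 0) :=
    tendsto_pow_atTop_nhds_zero_of_lt_one (by positivity) ((div_lt_one hBpos).2 hk)
  have hlimL : ∀ L : ℝ, Tendsto (fun n : ℕ => c * (L / 2 - K * (2 / B) ^ n)) atTop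
      (𝓝 (c * (L / 2 - K * 0))) := fun L =>
    (tendsto_const_nhds.sub (hlim.const_mul K)).const_mul c
  refine ⟨?_, ?_⟩
  · by_contra hlt
    push Not at hlt
    have hk0 : k ≠ 0 := by
      rintro rfl
      rw [hB, pow_zero] at hk
      norm_num at hk
    have hGB : G < B := pow_lt_pow_left₀ hlt hγ hk0
    have hlimG : Tendsto (fun n : ℕ => (G / B) ^ n * (h b - h a)) atTop (𝓝 (0 * (h b - h a))) :=
      (tendsto_pow_atTop_nhds_zero_of_lt_one (div_nonneg (pow_nonneg hγ k) hBpos.le)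
        ((div_lt_one hBpos).2 hGB)).mul_const _
    have ha : a ∈ Icc a b := left_mem_Icc.2 hab.le
    have hb : b ∈ Icc a b := right_mem_Icc.2 hab.le
    have := le_of_tendsto_of_tendsto' (hlimL (l b - l a)) hlimG
      fun n => hdiv n a ha b hb hab.le
    have h5 := hl ha hb hab
    have h6 : 0 < c * (l b - l a) := mul_pos hc (by linarith)
    linarith
  · rintro rfl
    refine ⟨c / 2, by positivity, fun x hx y hy hxy => ?_⟩
    have := le_of_tendsto (hlimL (l y - l x)) (b := h y - h x) (Eventually.of_forall fun n => by
      have := hdiv n x hx y hy hxy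
      rwa [div_self hBpos.ne', one_pow, one_mul] at this)
    linarith

lemma scal_of_slope {a b : ℝ} {f g φ : ℝ → ℝ} {β : ℝ}
    (hf : MapsTo f (Icc a b) (Icc a b)) 
    (hm : StrictMonoOn φ (Icc a b))
    (hbij : BijOn φ (Icc a b) (Icc 0 1))
    (hconj : ∀ x ∈ Icc a b, g (φ x) = φ (f x))
    (hslope : ∃ (m : ℕ) (s : ℕ → ℝ), 0 < m ∧ s 0 = 0 ∧ s m = 1 ∧
      (∀ j < m, s j < s (j + 1)) ∧
      ∀ j < m, ∀ u ∈ Icc (s j) (s (j + 1)), ∀ v ∈ Icc (s j) (s (j + 1)),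
        |g u - g v| = β * |u - v|) : ∃ T : Finset ℝ, Scal a b f φ β T := by
  obtain ⟨m, s, hm0, hs0, hsm, hsmono, hs⟩ := hslope
  have hfin : {x | x ∈ Icc a b ∧ φ x ∈ s '' {j | j ≤ m}}.Finite := by
    refine Set.Finite.of_finite_image (f := φ)
      (((Set.finite_le_nat m).image s).subset ?_) (hbij.injOn.mono fun x hx => hx.1)
    rintro _ ⟨x, hx, rfl⟩
    exact hx.2
  refine ⟨hfin.toFinset, fun x hx y hy hxy hcut => ?_⟩
  rcases hxy.eq_or_lt with rfl | hlt
  · simp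
  have hφ := hm hx hy hlt
  have hx1 := hbij.mapsTo hx
  have hy1 := hbij.mapsTo hy
  -- first index whose successor exceeds `φ x`
  have hex : ∃ j, φ x < s j := ⟨m, by rw [hsm]; linarith [hy1.2]⟩
  classical
  obtain ⟨j, hj, hjmin⟩ : ∃ j, φ x < s j ∧ ∀ i < j, s i ≤ φ x :=
    ⟨Nat.find hex, Nat.find_spec hex, fun i hi => not_lt.1 (Nat.find_min hex hi)⟩
  have hjm : j ≤ m := by
    by_contra hcon
    have := hjmin m (not_le.1 hcon)
    rw [hsm] at this
    linarith [hy1.2]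
  have hj0 : j ≠ 0 := by
    rintro rfl
    rw [hs0] at hj
    linarith [hx1.1]
  obtain ⟨i, rfl⟩ := Nat.exists_eq_succ_of_ne_zero hj0
  have h1 : s i ≤ φ x := hjmin i (Nat.lt_succ_self i)
  have h2 : φ y ≤ s (i + 1) := by
    by_contra hcon
    push Not at hcon
    obtain ⟨z, hz, hzs⟩ := hbij.surjOn (show s (i + 1) ∈ Icc (0 : ℝ) 1 from
      ⟨hx1.1.trans hj.le, hcon.le.trans hy1.2⟩)
    refine hcut z ?_ ⟨(hm.lt_iff_lt hx hz).1 (by rw [hzs]; exact hj),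
      (hm.lt_iff_lt hz hy).1 (by rw [hzs]; exact hcon)⟩
    rw [Set.Finite.mem_toFinset]
    exact ⟨hz, i + 1, hjm, hzs.symm⟩
  have := hs i (by omega) (φ y) ⟨h1.trans hφ.le, h2⟩ (φ x) ⟨h1, hφ.le.trans h2⟩
  rwa [hconj x hx, hconj y hy] at this

lemma endpoint_vals {a b : ℝ} (hab : a < b) {φ : ℝ → ℝ} (hm : StrictMonoOn φ (Icc a b))
    (hbij : BijOn φ (Icc a b) (Icc 0 1)) : φ a = 0 ∧ φ b = 1 := by
  have ha : a ∈ Icc a b := left_mem_Icc.2 hab.le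
  have hb : b ∈ Icc a b := right_mem_Icc.2 hab.le
  obtain ⟨z, hz, hz0⟩ := hbij.surjOn (show (0 : ℝ) ∈ Icc (0 : ℝ) 1 by simp)
  obtain ⟨w, hw, hw1⟩ := hbij.surjOn (show (1 : ℝ) ∈ Icc (0 : ℝ) 1 by simp)
  have h1 := hm.monotoneOn ha hz hz.1
  have h2 := hm.monotoneOn hw hb hw.2
  have h3 := (hbij.mapsTo ha).1
  have h4 := (hbij.mapsTo hb).2
  constructor <;> linarith


/-- a continuous, transitive, piecewise monotone map `f : I → I` is
conjugate, via an increasing homeomorphism `I → [0,1]`, to exactly one continuous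
piecewise monotone map of constant slope: if `φ₁, φ₂` are increasing homeomorphisms
conjugating `f` to constant-slope maps `g₁, g₂` (of slopes `β₁, β₂`), then `φ₁ = φ₂`,
`g₁ = g₂` and `β₁ = β₂`. -/
theorem stmt_12 {a b : ℝ} (hab : a < b) (f g₁ g₂ φ₁ φ₂ : ℝ → ℝ) {β₁ β₂ : ℝ}
    (hf : MapsTo f (Icc a b) (Icc a b))
    (hfc : ContinuousOn f (Icc a b))
    -- `f` is piecewise monotone: monotone on each closed lap `[t_i, t_{i+1}]`
    (hfpm : ∃ (m : ℕ) (t : ℕ → ℝ), 0 < m ∧ t 0 = a ∧ t m = b ∧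
      (∀ i < m, t i < t (i + 1)) ∧
      ∀ i < m, MonotoneOn f (Icc (t i) (t (i + 1))) ∨
        AntitoneOn f (Icc (t i) (t (i + 1))))
    -- `f` is transitive
    (hftrans : ∃ x₀ ∈ Icc a b, Icc a b ⊆ closure (Set.range fun n : ℕ => f^[n] x₀))
    -- `φ₁, φ₂` are increasing homeomorphisms of `I` onto `[0,1]`
    (hφ₁c : ContinuousOn φ₁ (Icc a b)) (hφ₁m : StrictMonoOn φ₁ (Icc a b))
    (hφ₁bij : BijOn φ₁ (Icc a b) (Icc 0 1))
    (hφ₂c : ContinuousOn φ₂ (Icc a b)) (hφ₂m : StrictMonoOn φ₂ (Icc a b))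
    (hφ₂bij : BijOn φ₂ (Icc a b) (Icc 0 1))
    -- `g₁ = φ₁ ∘ f ∘ φ₁⁻¹` and `g₂ = φ₂ ∘ f ∘ φ₂⁻¹`
    (hg₁ : MapsTo g₁ (Icc 0 1) (Icc 0 1))
    (hg₂ : MapsTo g₂ (Icc 0 1) (Icc 0 1))
    (hconj₁ : ∀ x ∈ Icc a b, g₁ (φ₁ x) = φ₁ (f x))
    (hconj₂ : ∀ x ∈ Icc a b, g₂ (φ₂ x) = φ₂ (f x))
    -- `g₁, g₂` are continuous piecewise monotone of constant slopes `β₁, β₂`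
    (hg₁c : ContinuousOn g₁ (Icc 0 1))
    (hg₂c : ContinuousOn g₂ (Icc 0 1))
    (hg₁slope : ∃ (m : ℕ) (s : ℕ → ℝ), 0 < m ∧ s 0 = 0 ∧ s m = 1 ∧
      (∀ j < m, s j < s (j + 1)) ∧
      ∀ j < m, ∀ u ∈ Icc (s j) (s (j + 1)), ∀ v ∈ Icc (s j) (s (j + 1)),
        |g₁ u - g₁ v| = β₁ * |u - v|)
    (hg₂slope : ∃ (m : ℕ) (s : ℕ → ℝ), 0 < m ∧ s 0 = 0 ∧ s m = 1 ∧
      (∀ j < m, s j < s (j + 1)) ∧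
      ∀ j < m, ∀ u ∈ Icc (s j) (s (j + 1)), ∀ v ∈ Icc (s j) (s (j + 1)),
        |g₂ u - g₂ v| = β₂ * |u - v|) :
    (∀ x ∈ Icc a b, φ₁ x = φ₂ x) ∧ (∀ z ∈ Icc (0 : ℝ) 1, g₁ z = g₂ z) ∧ β₁ = β₂ := by
  obtain ⟨x₀, hx₀, hd⟩ := hftrans
  obtain ⟨T₁, H₁'⟩ := scal_of_slope hf hφ₁m hφ₁bij hconj₁ hg₁slope
  obtain ⟨T₂, H₂'⟩ := scal_of_slope hf hφ₂m hφ₂bij hconj₂ hg₂slope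
  have H₁ := H₁'.mono (Finset.subset_union_left (s₂ := T₂))
  have H₂ := H₂'.mono (Finset.subset_union_right (s₁ := T₁))
  set T := T₁ ∪ T₂ with hT
  have hβ₁ := one_lt_slope hab hf hfc hx₀ hd hφ₁m H₁
  have hβ₂ := one_lt_slope hab hf hfc hx₀ hd hφ₂m H₂
  have hβ : β₁ = β₂ := le_antisymm
    (compare hab hf hfc hφ₁m hφ₁c hφ₂m hφ₂c H₁ H₂ hβ₁ (by linarith)).1
    (compare hab hf hfc hφ₂m hφ₂c hφ₁m hφ₁c H₂ H₁ hβ₂ (by linarith)).1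
  subst hβ
  have ha : a ∈ Icc a b := left_mem_Icc.2 hab.le
  have hb : b ∈ Icc a b := right_mem_Icc.2 hab.le
  obtain ⟨e1a, e1b⟩ := endpoint_vals hab hφ₁m hφ₁bij
  obtain ⟨e2a, e2b⟩ := endpoint_vals hab hφ₂m hφ₂bij
  have hφ : ∀ x ∈ Icc a b, φ₁ x = φ₂ x := by
    set S : Set ℝ := {c | ∀ x ∈ Icc a b, ∀ y ∈ Icc a b, x ≤ y →
      c * (φ₂ y - φ₂ x) ≤ φ₁ y - φ₁ x} with hS
    have hSb : ∀ c ∈ S, c ≤ 1 := by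
      intro c hc
      have := hc a ha b hb hab.le
      rw [e1a, e1b, e2a, e2b] at this
      linarith
    have hS0 : (0 : ℝ) ∈ S := by
      intro x hx y hy hxy
      have := hφ₁m.monotoneOn hx hy hxy
      linarith
    have hbdd : BddAbove S := ⟨1, hSb⟩
    set c := sSup S with hc
    have hcS : c ∈ S := by
      intro x hx y hy hxy
      rcases hxy.eq_or_lt with rfl | hlt
      · simp
      have h2 : 0 < φ₂ y - φ₂ x := sub_pos.2 (hφ₂m hx hy hlt)
      rw [← le_div_iff₀ h2]
      refine csSup_le ⟨0, hS0⟩ fun d hd => ?_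
      rw [le_div_iff₀ h2]
      exact hd x hx y hy hxy
    set h : ℝ → ℝ := fun x => φ₁ x - c * φ₂ x with hh
    have hhm : MonotoneOn h (Icc a b) := by
      intro x hx y hy hxy
      have := hcS x hx y hy hxy
      simp only [hh]
      linarith
    have hhc : ContinuousOn h (Icc a b) := hφ₁c.sub (continuousOn_const.mul hφ₂c)
    have Hh : Scal a b f h β₁ T := by
      intro x hx y hy hxy hcut
      have k1 := H₁ x hx y hy hxy hcut
      have k2 := H₂ x hx y hy hxy hcut
      rw [abs_of_nonneg (sub_nonneg.2 (hhm hx hy hxy))]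
      rw [abs_of_nonneg (sub_nonneg.2 (hφ₁m.monotoneOn hx hy hxy))] at k1
      rw [abs_of_nonneg (sub_nonneg.2 (hφ₂m.monotoneOn hx hy hxy))] at k2
      rcases le_total (f x) (f y) with hfxy | hfxy
      · rw [abs_of_nonneg (sub_nonneg.2 (hhm (hf hx) (hf hy) hfxy))]
        rw [abs_of_nonneg (sub_nonneg.2 (hφ₁m.monotoneOn (hf hx) (hf hy) hfxy))] at k1
        rw [abs_of_nonneg (sub_nonneg.2 (hφ₂m.monotoneOn (hf hx) (hf hy) hfxy))] at k2
        simp only [hh]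
        linear_combination k1 - c * k2
      · rw [abs_of_nonpos (sub_nonpos.2 (hhm (hf hy) (hf hx) hfxy))]
        rw [abs_of_nonpos (sub_nonpos.2 (hφ₁m.monotoneOn (hf hy) (hf hx) hfxy))] at k1
        rw [abs_of_nonpos (sub_nonpos.2 (hφ₂m.monotoneOn (hf hy) (hf hx) hfxy))] at k2
        simp only [hh]
        linear_combination k1 - c * k2
    have hnot : ¬ StrictMonoOn h (Icc a b) := by
      intro hstrict
      obtain ⟨d, hd0, hdd⟩ :=
        (compare hab hf hfc hφ₂m hφ₂c hstrict hhc H₂ Hh hβ₂ (by linarith)).2 rfl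
      have : c + d ∈ S := by
        intro x hx y hy hxy
        have := hdd x hx y hy hxy
        simp only [hh] at this
        linarith
      have := le_csSup hbdd this
      linarith
    have hflat : ∃ u ∈ Icc a b, ∃ v ∈ Icc a b, u < v ∧ h v ≤ h u := by
      by_contra hcon
      push Not at hcon
      exact hnot fun u hu v hv huv => hcon u hu v hv huv
    obtain ⟨u, hu, v, hv, huv, huv2⟩ := hflat
    have hconst := const_of_flat hf hx₀ hd hhm hhc Hh hu hv huv huv2
    have hcab := hconst a ha b hb
    simp only [hh, e1a, e1b, e2a, e2b] at hcab
    have hc1 : c = 1 := by linarith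
    intro x hx
    have := hconst x hx a ha
    simp only [hh, e1a, e2a, hc1] at this
    linarith
  refine ⟨hφ, ?_, rfl⟩
  intro z hz
  obtain ⟨x, hx, rfl⟩ := hφ₁bij.surjOn hz
  rw [hconj₁ x hx, hφ x hx, hconj₂ x hx, hφ _ (hf hx)]
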